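/- Stochastic domination by the measure with boundary conditions: Let G = (V, E) be a finite connected graph and G′ = (V′, E′) a connected subgraph. For each e ∈ E let ρ_e be a nonzero finite Borel measure on (0,∞) supported in [λ^{−1}, λ] for some λ ≥ 1. Fix boundary conductances α ∈ (0,∞)^{E∖E′}. Let μ^{G′} be the probability measure on (0,∞)^{E′} with density proportional to D_{G′}(κ)^{−1/2} with respect to ⊗_{e∈E′}ρ_e, and let μ^{G,E′,α} be the probability measure on (0,∞)^{E′} with density proportional to D_G((κ, α))^{−1/2} with respect to ⊗_{e∈E′}ρ_e, where (κ, α) ∈ (0,∞)^E equals κ on E′ and α on E∖E′. Then μ^{G′} is stochastically dominated by μ^{G,E′,α}: ∫ f dμ^{G′} ≤ ∫ f dμ^{G,E′,α} for every bounded measurable increasing f : (0,∞)^{E′} → ℝ. -/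

import Mathlib

open MeasureTheory
open scoped Classical

/-- The weighted graph Laplacian of a finite graph `G` with conductances
`κ : Sym2 α → ℝ`. -/
noncomputable def glap {α : Type*} [Fintype α] (G : SimpleGraph α) (κ : Sym2 α → ℝ) :
    Matrix α α ℝ :=
  Matrix.of fun x y =>
    if x = y then ∑ z : α, (if G.Adj x z then κ s(x, z) else 0)
    else if G.Adj x y then -κ s(x, y) else 0

/-- The reduced determinant `det L(κ)[α∖W]`. -/
noncomputable def gdet {α : Type*} [Fintype α] (G : SimpleGraph α) (κ : Sym2 α → ℝ)
    (W : Set α) : ℝ :=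
  ((glap G κ).submatrix (fun x : {x : α // x ∉ W} => (x : α))
    (fun x : {x : α // x ∉ W} => (x : α))).det

/-- Conductances on the coerced subgraph `H.coe` obtained from a configuration
`c : H.edgeSet → ℝ` on the edges of the subgraph `H`. -/
noncomputable def subCond {V : Type*} {G : SimpleGraph V} (H : G.Subgraph)
    (c : H.edgeSet → ℝ) : Sym2 H.verts → ℝ :=
  fun e => if h : Sym2.map Subtype.val e ∈ H.edgeSet then c ⟨Sym2.map Subtype.val e, h⟩ else 1

/-- The configuration `(κ, α)` on `Sym2 V`: equal to `c` on the edges of the subgraph `H`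
and to the boundary conductances `a` elsewhere. -/
noncomputable def combineCond {V : Type*} {G : SimpleGraph V} (H : G.Subgraph)
    (c : H.edgeSet → ℝ) (a : Sym2 V → ℝ) : Sym2 V → ℝ :=
  fun e => if h : e ∈ H.edgeSet then c ⟨e, h⟩ else a e

/-- The numerical inequality behind the four functions theorem. -/
lemma ENNReal.add_le_add_of_le_of_mul_le {A B C D : ENNReal} (hA : A ≤ C) (hB : B ≤ C)
    (h : A * B ≤ C * D) : A + B ≤ C + D := by
  rcases eq_or_ne C ⊤ with rfl | hC
  · simp
  rcases eq_or_ne D ⊤ with rfl | hD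
  · simp
  lift C to NNReal using hC
  lift D to NNReal using hD
  lift A to NNReal using (lt_of_le_of_lt hA ENNReal.coe_lt_top).ne
  lift B to NNReal using (lt_of_le_of_lt hB ENNReal.coe_lt_top).ne
  norm_cast at *
  rw [← NNReal.coe_le_coe] at *
  push_cast at *
  rcases eq_or_lt_of_le C.2 with hC | hC
  · have : (C : ℝ) = 0 := hC.symm
    linarith [D.2]
  · have hC : (0 : ℝ) < C := hC
    nlinarith [mul_nonneg (sub_nonneg.2 hA) (sub_nonneg.2 hB)]

/-- The four functions theorem on the real line. -/
lemma lintegral_mul_lintegral_le_of_inf_sup (ν : Measure ℝ) [SFinite ν]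
    {f₁ f₂ f₃ f₄ : ℝ → ENNReal} (h₁ : Measurable f₁) (h₂ : Measurable f₂) (h₃ : Measurable f₃)
    (h₄ : Measurable f₄) (h : ∀ s t, f₁ s * f₂ t ≤ f₃ (s ⊓ t) * f₄ (s ⊔ t)) :
    (∫⁻ s, f₁ s ∂ν) * ∫⁻ t, f₂ t ∂ν ≤ (∫⁻ s, f₃ s ∂ν) * ∫⁻ t, f₄ t ∂ν := by
  have symmetrize : ∀ {g k : ℝ → ENNReal}, Measurable g → Measurable k →
      ∫⁻ s, ∫⁻ t, (g s * k t + g t * k s) ∂ν ∂ν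
        = 2 * ((∫⁻ s, g s ∂ν) * ∫⁻ t, k t ∂ν) := by
    intro g k hg hk
    rw [two_mul, ← lintegral_lintegral_mul hg.aemeasurable hk.aemeasurable]
    nth_rw 3 [lintegral_lintegral_swap (by fun_prop)]
    rw [← lintegral_add_left (by fun_prop)]
    refine lintegral_congr fun s => ?_
    rw [lintegral_add_left (by fun_prop)]
  refine (ENNReal.mul_le_mul_iff_right (a := 2) (by simp) (by simp)).1 ?_
  rw [← symmetrize h₁ h₂, ← symmetrize h₃ h₄]
  refine lintegral_mono fun s => lintegral_mono fun t => ?_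
  have key : ∀ s t, s ≤ t →
      f₁ s * f₂ t + f₁ t * f₂ s ≤ f₃ s * f₄ t + f₃ t * f₄ s := by
    intro s t hst
    have hs := h s s
    have ht := h t t
    have h_st := h s t
    have h_ts := h t s
    simp only [inf_idem, sup_idem, inf_of_le_left hst, inf_of_le_right hst, sup_of_le_left hst,
      sup_of_le_right hst] at hs ht h_st h_ts
    refine ENNReal.add_le_add_of_le_of_mul_le h_st h_ts ?_
    calc f₁ s * f₂ t * (f₁ t * f₂ s) = f₁ s * f₂ s * (f₁ t * f₂ t) := by ring
      _ ≤ f₃ s * f₄ s * (f₃ t * f₄ t) := mul_le_mul' hs ht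
      _ = _ := by ring
  rcases le_total s t with hst | hst
  · exact key s t hst
  · simpa only [add_comm] using key t s hst

/-- The four functions theorem for a finite product of measures on the real line. -/
lemma lintegral_pi_mul_lintegral_pi_le_of_inf_sup {ι : Type*} [Fintype ι]
    (ν : ι → Measure ℝ) [∀ i, SigmaFinite (ν i)] {f₁ f₂ f₃ f₄ : (ι → ℝ) → ENNReal}
    (h₁ : Measurable f₁) (h₂ : Measurable f₂) (h₃ : Measurable f₃) (h₄ : Measurable f₄)
    (h : ∀ x y, f₁ x * f₂ y ≤ f₃ (x ⊓ y) * f₄ (x ⊔ y)) :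
    (∫⁻ x, f₁ x ∂Measure.pi ν) * ∫⁻ x, f₂ x ∂Measure.pi ν
      ≤ (∫⁻ x, f₃ x ∂Measure.pi ν) * ∫⁻ x, f₄ x ∂Measure.pi ν := by
  have key : ∀ (s : Finset ι) (x y : ι → ℝ),
      lmarginal ν s f₁ x * lmarginal ν s f₂ y
        ≤ lmarginal ν s f₃ (x ⊓ y) * lmarginal ν s f₄ (x ⊔ y) := by
    intro s
    induction s using Finset.induction with
    | empty => simpa using h
    | insert i s hi ih =>
      intro x y
      simp only [lmarginal_insert _ h₁ hi, lmarginal_insert _ h₂ hi, lmarginal_insert _ h₃ hi,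
        lmarginal_insert _ h₄ hi]
      have hu : ∀ z : ι → ℝ, Measurable (Function.update z i) := fun z => measurable_update z
      refine lintegral_mul_lintegral_le_of_inf_sup (ν i) ((h₁.lmarginal ν).comp (hu x))
        ((h₂.lmarginal ν).comp (hu y)) ((h₃.lmarginal ν).comp (hu _))
        ((h₄.lmarginal ν).comp (hu _)) fun s t => ?_
      have h_inf : Function.update (x ⊓ y) i (s ⊓ t)
          = Function.update x i s ⊓ Function.update y i t := by
        ext j; by_cases hj : j = i <;> simp [hj]
      have h_sup : Function.update (x ⊔ y) i (s ⊔ t)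
          = Function.update x i s ⊔ Function.update y i t := by
        ext j; by_cases hj : j = i <;> simp [hj]
      rw [h_inf, h_sup]
      exact ih _ _
  simpa using key Finset.univ 0 0

/-- **Holley's inequality** for densities on the positive orthant with respect to a finite product
of measures. -/
lemma integral_le_integral_of_holley {ι : Type*} [Fintype ι] (ν : ι → Measure ℝ)
    [∀ i, SigmaFinite (ν i)] (hpos : ∀ᵐ x ∂Measure.pi ν, ∀ i, 0 < x i)
    {p q : (ι → ℝ) → ENNReal} (hp : Measurable p) (hq : Measurable q)
    [IsProbabilityMeasure ((Measure.pi ν).withDensity p)]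
    [IsProbabilityMeasure ((Measure.pi ν).withDensity q)]
    (h : ∀ x y, (∀ i, 0 < x i) → (∀ i, 0 < y i) → p x * q y ≤ p (x ⊓ y) * q (x ⊔ y))
    {f : (ι → ℝ) → ℝ} (hf : Measurable f) (hbdd : ∃ C, ∀ x, |f x| ≤ C)
    (hmono : ∀ x y, (∀ i, 0 < x i) → (∀ i, 0 < y i) → x ≤ y → f x ≤ f y) :
    ∫ x, f x ∂(Measure.pi ν).withDensity p ≤ ∫ x, f x ∂(Measure.pi ν).withDensity q := by
  obtain ⟨C, hC⟩ := hbdd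
  set g : (ι → ℝ) → ENNReal := fun x => ENNReal.ofReal (f x + C) with hg_def
  have hg : Measurable g := by fun_prop
  have f_nonneg : ∀ x, 0 ≤ f x + C := fun x => by linarith [neg_abs_le (f x), hC x]
  have shift : ∀ (μ : Measure (ι → ℝ)) [IsProbabilityMeasure μ],
      Integrable f μ ∧ ∫ x, f x ∂μ = (∫⁻ x, g x ∂μ).toReal - C := by
    intro μ _
    have hint : Integrable f μ :=
      Integrable.of_bound hf.aestronglyMeasurable C (.of_forall hC)
    refine ⟨hint, ?_⟩
    rw [← integral_eq_lintegral_of_nonneg_ae (.of_forall f_nonneg) (by fun_prop),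
      integral_add hint (integrable_const C)]
    simp
  rw [(shift _).2, (shift _).2]
  have hfin : ∫⁻ x, g x ∂(Measure.pi ν).withDensity q ≠ ⊤ :=
    ((shift _).1.add (integrable_const C)).lintegral_lt_top.ne
  refine sub_le_sub_right (ENNReal.toReal_mono hfin ?_) C
  set P : Set (ι → ℝ) := {x | ∀ i, 0 < x i} with hP_def
  have hP : MeasurableSet P := by
    simp only [hP_def, Set.ofPred_forall]
    exact MeasurableSet.iInter fun i => measurableSet_lt measurable_const (measurable_pi_apply i)
  have ind : ∀ k : (ι → ℝ) → ENNReal,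
      ∫⁻ x, P.indicator k x ∂Measure.pi ν = ∫⁻ x, k x ∂Measure.pi ν := by
    intro k
    refine lintegral_congr_ae ?_
    filter_upwards [hpos] with x hx
    exact Set.indicator_of_mem (s := P) hx k
  have total : ∀ {k : (ι → ℝ) → ENNReal} [IsProbabilityMeasure ((Measure.pi ν).withDensity k)],
      ∫⁻ x, k x ∂Measure.pi ν = 1 := by
    intro k hk
    rw [← setLIntegral_univ, ← withDensity_apply _ MeasurableSet.univ]
    exact hk.measure_univ
  have four := lintegral_pi_mul_lintegral_pi_le_of_inf_sup ν ((hp.mul hg).indicator hP)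
    (hq.indicator hP) (hp.indicator hP) ((hq.mul hg).indicator hP) fun x y => by
      by_cases hx : x ∈ P
      · by_cases hy : y ∈ P
        · have h_inf : x ⊓ y ∈ P := fun i => lt_inf_iff.2 ⟨hx i, hy i⟩
          have h_sup : x ⊔ y ∈ P := fun i => lt_sup_of_lt_left (hx i)
          simp only [Set.indicator_of_mem, hx, hy, h_inf, h_sup, Pi.mul_apply]
          calc p x * g x * q y = p x * q y * g x := by ring
            _ ≤ p (x ⊓ y) * q (x ⊔ y) * g (x ⊔ y) :=
              mul_le_mul' (h x y hx hy) (ENNReal.ofReal_le_ofReal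
                (add_le_add_left (hmono _ _ hx h_sup le_sup_left) C))
            _ = _ := by ring
        · simp [hy]
      · simp [hx]
  rw [ind, ind, ind, ind, total (k := q), total (k := p), mul_one, one_mul] at four
  rwa [lintegral_withDensity_eq_lintegral_mul _ hp hg,
    lintegral_withDensity_eq_lintegral_mul _ hq hg]

open Matrix in
/-- The matrix determinant lemma for a symmetric rank one perturbation, together with the
variational characterization of the coefficient. -/
lemma Matrix.PosDef.exists_det_add_smul_vecMulVec {n : Type*} [Fintype n] [DecidableEq n]
    {A : Matrix n n ℝ} (hA : A.PosDef) (b : n → ℝ) :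
    ∃ R : ℝ, (∀ t : ℝ, (A + t • vecMulVec b b).det = A.det * (1 + t * R)) ∧
      (∃ f, R = 2 * (b ⬝ᵥ f) - f ⬝ᵥ A *ᵥ f) ∧ ∀ f, 2 * (b ⬝ᵥ f) - f ⬝ᵥ A *ᵥ f ≤ R := by
  have hdet : IsUnit A.det := hA.det_pos.ne'.isUnit
  set g := A⁻¹ *ᵥ b with hg
  have hAg : A *ᵥ g = b := by
    rw [hg, mulVec_mulVec, mul_nonsing_inv _ hdet, one_mulVec]
  have hsymm : ∀ f, g ⬝ᵥ A *ᵥ f = b ⬝ᵥ f := by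
    intro f
    have hT : Aᵀ = A := by simpa [IsHermitian, conjTranspose_eq_transpose_of_trivial] using hA.1
    rw [dotProduct_mulVec, ← mulVec_transpose, hT, hAg]
  refine ⟨b ⬝ᵥ g, fun t => ?_, ⟨g, ?_⟩, fun f => ?_⟩
  · have hrank : t • vecMulVec b b
        = replicateCol Unit (t • b) * replicateRow Unit b := by
      rw [← smul_vecMulVec, vecMulVec_eq Unit]
    rw [hrank, det_add_replicateCol_mul_replicateRow hdet]
    congr 1
    rw [det_unique, Matrix.mul_assoc, ← replicateCol_mulVec]
    simp [mulVec_smul, hg, replicateRow_mul_replicateCol_apply]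
  · rw [hAg, dotProduct_comm g b]; ring
  · have h := hA.posSemidef.dotProduct_mulVec_nonneg (f - g)
    rw [star_trivial, mulVec_sub, sub_dotProduct, dotProduct_sub, dotProduct_sub, hsymm, hAg,
      dotProduct_comm f b, dotProduct_comm g b] at h
    linarith

/-- Twice the Dirichlet energy of `f` on the weighted graph `(G, κ)`. -/
noncomputable def dirichletSum {α : Type*} [Fintype α] (G : SimpleGraph α) (κ : Sym2 α → ℝ)
    (f : α → ℝ) : ℝ :=
  ∑ x, ∑ y, if G.Adj x y then κ s(x, y) * (f x - f y) ^ 2 else 0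

/-- The Laplacian of `G` reduced at the vertex `v`. -/
noncomputable def reducedLap {α : Type*} [Fintype α] (G : SimpleGraph α) (κ : Sym2 α → ℝ) (v : α) :
    Matrix {x : α // x ∉ ({v} : Set α)} {x : α // x ∉ ({v} : Set α)} ℝ :=
  (glap G κ).submatrix (fun x => (x : α)) (fun x => (x : α))

/-- Extension by zero of a function on the vertices other than `v`. -/
noncomputable def extendZero {α : Type*} (v : α) (f : {x : α // x ∉ ({v} : Set α)} → ℝ) : α → ℝ :=
  fun x => if h : x ∉ ({v} : Set α) then f ⟨x, h⟩ else 0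

lemma extendZero_coe (v : α) (f : {x : α // x ∉ ({v} : Set α)} → ℝ)
    (x : {x : α // x ∉ ({v} : Set α)}) : extendZero v f x = f x := by
  simp only [extendZero, dif_pos x.2]

lemma extendZero_self (v : α) (f : {x : α // x ∉ ({v} : Set α)} → ℝ) :
    extendZero v f v = 0 := by
  simp [extendZero]

section Laplacian

variable {α : Type*} [Fintype α] (G : SimpleGraph α) (κ : Sym2 α → ℝ)

lemma sum_mul_extendZero (v : α) (f : {x : α // x ∉ ({v} : Set α)} → ℝ) (g : α → ℝ) :
    ∑ x, g x * extendZero v f x = ∑ x : {x : α // x ∉ ({v} : Set α)}, g x * f x := by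
  rw [← Fintype.sum_subtype_add_sum_subtype (fun x => x ∉ ({v} : Set α))]
  simp only [extendZero_coe]
  rw [add_eq_left]
  refine Finset.sum_eq_zero fun x _ => ?_
  have : (x : α) = v := by simpa using x.2
  rw [this, extendZero_self, mul_zero]

open Matrix in
lemma glap_mulVec (f : α → ℝ) (x : α) :
    (glap G κ *ᵥ f) x = ∑ y, if G.Adj x y then κ s(x, y) * (f x - f y) else 0 := by
  have h : ∀ y, glap G κ x y * f y
      = (if x = y then (∑ z, if G.Adj x z then κ s(x, z) else 0) * f x else 0)
        - (if G.Adj x y then κ s(x, y) * f y else 0) := by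
    intro y
    by_cases hxy : x = y
    · subst hxy; simp [glap]
    · by_cases hA : G.Adj x y <;> simp [glap, hxy, hA]
  simp only [mulVec, dotProduct, h, Finset.sum_sub_distrib, Finset.sum_ite_eq, Finset.mem_univ,
    if_true]
  rw [Finset.sum_mul, ← Finset.sum_sub_distrib]
  refine Finset.sum_congr rfl fun y _ => ?_
  split_ifs <;> ring

open Matrix in
lemma two_mul_dotProduct_glap_mulVec (f : α → ℝ) :
    2 * (f ⬝ᵥ glap G κ *ᵥ f) = dirichletSum G κ f := by
  have h₁ : f ⬝ᵥ glap G κ *ᵥ f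
      = ∑ x, ∑ y, if G.Adj x y then κ s(x, y) * (f x * (f x - f y)) else 0 := by
    simp only [dotProduct, glap_mulVec, Finset.mul_sum]
    refine Finset.sum_congr rfl fun x _ => Finset.sum_congr rfl fun y _ => ?_
    split_ifs <;> ring
  have h₂ : f ⬝ᵥ glap G κ *ᵥ f
      = ∑ x, ∑ y, if G.Adj x y then κ s(x, y) * (f y * (f y - f x)) else 0 := by
    rw [h₁, Finset.sum_comm]
    simp only [G.adj_comm, Sym2.eq_swap]
  rw [two_mul]
  nth_rw 1 [h₁]
  rw [h₂, dirichletSum, ← Finset.sum_add_distrib]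
  refine Finset.sum_congr rfl fun x _ => ?_
  rw [← Finset.sum_add_distrib]
  refine Finset.sum_congr rfl fun y _ => ?_
  split_ifs <;> ring

open Matrix in
lemma reducedLap_mulVec (v : α) (f : {x : α // x ∉ ({v} : Set α)} → ℝ)
    (x : {x : α // x ∉ ({v} : Set α)}) :
    (reducedLap G κ v *ᵥ f) x = (glap G κ *ᵥ extendZero v f) x := by
  simp only [mulVec, dotProduct, reducedLap, submatrix_apply]
  rw [sum_mul_extendZero]

open Matrix in
lemma two_mul_dotProduct_reducedLap_mulVec (v : α) (f : {x : α // x ∉ ({v} : Set α)} → ℝ) :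
    2 * (f ⬝ᵥ reducedLap G κ v *ᵥ f) = dirichletSum G κ (extendZero v f) := by
  rw [← two_mul_dotProduct_glap_mulVec, dotProduct_comm, dotProduct_comm (extendZero v f)]
  simp only [dotProduct, sum_mul_extendZero, reducedLap_mulVec]

lemma glap_isSymm : (glap G κ).IsSymm := by
  ext x y
  by_cases h : x = y
  · subst h; rfl
  · simp [glap, h, Ne.symm h, G.adj_comm y x, Sym2.eq_swap (a := y) (b := x)]

variable {G κ}

lemma dirichletSum_nonneg (hκ : ∀ e ∈ G.edgeSet, 0 < κ e) (f : α → ℝ) :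
    0 ≤ dirichletSum G κ f := by
  refine Finset.sum_nonneg fun x _ => Finset.sum_nonneg fun y _ => ?_
  split_ifs with h
  · exact mul_nonneg (hκ _ h).le (sq_nonneg _)
  · exact le_rfl

lemma eq_of_dirichletSum_eq_zero (hG : G.Connected) (hκ : ∀ e ∈ G.edgeSet, 0 < κ e) {f : α → ℝ}
    (hf : dirichletSum G κ f = 0) (x y : α) : f x = f y := by
  have nonneg : ∀ x y, 0 ≤ if G.Adj x y then κ s(x, y) * (f x - f y) ^ 2 else 0 := by
    intro x y
    split_ifs with h
    · exact mul_nonneg (hκ _ h).le (sq_nonneg _)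
    · exact le_rfl
  have adj : ∀ x y, G.Adj x y → f x = f y := by
    intro x y h
    have hx := (Finset.sum_eq_zero_iff_of_nonneg fun x _ => Finset.sum_nonneg fun y _ =>
      nonneg x y).1 hf x (Finset.mem_univ x)
    have hy := (Finset.sum_eq_zero_iff_of_nonneg fun y _ => nonneg x y).1 hx y (Finset.mem_univ y)
    rw [if_pos h] at hy
    have := (mul_eq_zero.1 hy).resolve_left (hκ _ h).ne'
    exact sub_eq_zero.1 (pow_eq_zero_iff two_ne_zero |>.1 this)
  obtain ⟨w⟩ := hG.preconnected x y
  induction w with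
  | nil => rfl
  | cons h _ ih => exact (adj _ _ h).trans ih

lemma reducedLap_posDef (hG : G.Connected) (hκ : ∀ e ∈ G.edgeSet, 0 < κ e) (v : α) :
    (reducedLap G κ v).PosDef := by
  refine .of_dotProduct_mulVec_pos ?_ fun f hf => ?_
  · rw [Matrix.IsHermitian, Matrix.conjTranspose_eq_transpose_of_trivial]
    exact (glap_isSymm G κ).submatrix _
  · have h := two_mul_dotProduct_reducedLap_mulVec G κ v f
    rw [star_trivial]
    suffices 0 < dirichletSum G κ (extendZero v f) by linarith
    refine lt_of_le_of_ne (dirichletSum_nonneg hκ _) fun h0 => hf ?_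
    ext x
    rw [← extendZero_coe v f x, eq_of_dirichletSum_eq_zero hG hκ h0.symm x v, extendZero_self]
    rfl

lemma gdet_pos (hG : G.Connected) (hκ : ∀ e ∈ G.edgeSet, 0 < κ e) (v : α) :
    0 < gdet G κ {v} :=
  (reducedLap_posDef hG hκ v).det_pos

open Matrix in
lemma glap_update [DecidableEq (Sym2 α)] {p q : α} (h : G.Adj p q) (t : ℝ) :
    glap G (Function.update κ s(p, q) (κ s(p, q) + t))
      = glap G κ + t • vecMulVec (Pi.single p 1 - Pi.single q 1) (Pi.single p 1 - Pi.single q 1) := by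
  have hpq : p ≠ q := h.ne
  rw [← mulVec_injective.eq_iff]
  ext f x
  have hdot : (Pi.single p 1 - Pi.single q 1 : α → ℝ) ⬝ᵥ f = f p - f q := by
    simp [sub_dotProduct]
  rw [add_mulVec, Pi.add_apply, glap_mulVec, glap_mulVec, smul_mulVec, vecMulVec_mulVec, hdot,
    ← sub_eq_iff_eq_add', ← Finset.sum_sub_distrib]
  have hterm : ∀ y, ((if G.Adj x y then
        Function.update κ s(p, q) (κ s(p, q) + t) s(x, y) * (f x - f y) else 0)
      - if G.Adj x y then κ s(x, y) * (f x - f y) else 0)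
      = (if y = q then (if x = p then t * (f p - f q) else 0) else 0)
        + (if y = p then (if x = q then t * (f q - f p) else 0) else 0) := by
    intro y
    by_cases hxy : s(x, y) = s(p, q)
    · rcases Sym2.eq_iff.1 hxy with ⟨rfl, rfl⟩ | ⟨rfl, rfl⟩
      · simp [h, hpq]; ring
      · simp [h.symm, hpq, Sym2.eq_swap (a := x)]; ring
    · rw [Function.update_of_ne hxy, sub_self]
      have h1 : ¬ (y = q ∧ x = p) := by rintro ⟨rfl, rfl⟩; exact hxy rfl
      have h2 : ¬ (y = p ∧ x = q) := by rintro ⟨rfl, rfl⟩; exact hxy Sym2.eq_swap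
      rw [← ite_and, ← ite_and, if_neg h1, if_neg h2, add_zero]
  simp only [hterm, Finset.sum_add_distrib, Finset.sum_ite_eq', Finset.mem_univ, if_true]
  by_cases hxp : x = p
  · subst hxp; simp [hpq]
  · by_cases hxq : x = q
    · subst hxq; simp [hxp]
    · simp [hxp, hxq]

/-- The reduced determinant is affine in each conductance, and its relative slope is an effective
resistance, which is characterized by the dual Dirichlet principle. -/
lemma exists_gdet_update_eq [DecidableEq (Sym2 α)] (hG : G.Connected)
    (hκ : ∀ e ∈ G.edgeSet, 0 < κ e) (v : α) {p q : α} (h : G.Adj p q) :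
    ∃ R : ℝ, (∀ t, gdet G (Function.update κ s(p, q) (κ s(p, q) + t)) {v}
        = gdet G κ {v} * (1 + t * R)) ∧
      (∃ f : α → ℝ, R = 2 * (f p - f q) - dirichletSum G κ f / 2) ∧
      ∀ f : α → ℝ, 2 * (f p - f q) - dirichletSum G κ f / 2 ≤ R := by
  set b : {x : α // x ∉ ({v} : Set α)} → ℝ :=
    fun x => (Pi.single p 1 - Pi.single q 1 : α → ℝ) x
  obtain ⟨R, hR, ⟨f₀, hf₀⟩, hmax⟩ :=
    (reducedLap_posDef hG hκ v).exists_det_add_smul_vecMulVec b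
  have hval : ∀ f, 2 * (b ⬝ᵥ f) - f ⬝ᵥ (reducedLap G κ v).mulVec f
      = 2 * (extendZero v f p - extendZero v f q) - dirichletSum G κ (extendZero v f) / 2 := by
    intro f
    have hbf : b ⬝ᵥ f = extendZero v f p - extendZero v f q := by
      rw [dotProduct, ← sum_mul_extendZero v f (Pi.single p 1 - Pi.single q 1)]
      simp [sub_mul, Pi.single_apply]
    rw [hbf, ← two_mul_dotProduct_reducedLap_mulVec]
    ring
  refine ⟨R, fun t => ?_, ⟨extendZero v f₀, by rw [hf₀, hval]⟩, fun f => ?_⟩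
  · rw [gdet, glap_update h t]
    exact hR t
  · refine le_of_eq_of_le ?_ (hmax fun x => f x - f v)
    rw [hval]
    have hext : extendZero v (fun x => f x - f v) = fun x => f x - f v := by
      ext x
      by_cases hx : x = v <;> simp [extendZero, hx]
    simp [hext, dirichletSum]

end Laplacian

section Subgraph

variable {V : Type*} {G : SimpleGraph V} {H : G.Subgraph}

lemma combineCond_update (c : H.edgeSet → ℝ) (a : Sym2 V → ℝ) (e : H.edgeSet) (r : ℝ) :
    combineCond H (Function.update c e r) a = Function.update (combineCond H c a) e r := by
  ext e'
  by_cases h : e' = e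
  · subst h; simp [combineCond]
  · rw [Function.update_of_ne h]
    by_cases h' : e' ∈ H.edgeSet
    · have : (⟨e', h'⟩ : H.edgeSet) ≠ e := fun h'' => h (congrArg Subtype.val h'')
      simp [combineCond, h', Function.update_of_ne this]
    · simp [combineCond, h']

lemma combineCond_coe (c : H.edgeSet → ℝ) (a : Sym2 V → ℝ) (e : H.edgeSet) :
    combineCond H c a e = c e := by
  simp [combineCond]

lemma combineCond_pos {c : H.edgeSet → ℝ} {a : Sym2 V → ℝ} (hc : ∀ e, 0 < c e)
    (ha : ∀ e ∈ G.edgeSet, e ∉ H.edgeSet → 0 < a e) : ∀ e ∈ G.edgeSet, 0 < combineCond H c a e := by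
  intro e he
  by_cases h : e ∈ H.edgeSet
  · simpa [combineCond, h] using hc _
  · simpa [combineCond, h] using ha e he h

lemma subCond_of_map_eq (c : H.edgeSet → ℝ) {e : Sym2 H.verts} {e' : H.edgeSet}
    (h : Sym2.map Subtype.val e = e') : subCond H c e = c e' := by
  have h' : Sym2.map Subtype.val e ∈ H.edgeSet := h ▸ e'.2
  rw [subCond, dif_pos h']
  exact congrArg c (Subtype.ext h)

lemma subCond_update [DecidableEq (Sym2 H.verts)] (c : H.edgeSet → ℝ) {e : Sym2 H.verts}
    {e' : H.edgeSet} (h : Sym2.map Subtype.val e = e') (r : ℝ) :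
    subCond H (Function.update c e' r) = Function.update (subCond H c) e r := by
  ext k
  by_cases hk : k = e
  · subst hk; rw [subCond_of_map_eq _ h]; simp
  · rw [Function.update_of_ne hk]
    by_cases h' : Sym2.map Subtype.val k ∈ H.edgeSet
    · rw [subCond_of_map_eq (e' := ⟨_, h'⟩) _ rfl, subCond_of_map_eq (e' := ⟨_, h'⟩) _ rfl,
        Function.update_of_ne]
      intro hke
      refine hk (Sym2.map.injective Subtype.val_injective ?_)
      rw [h, ← hke]
    · simp [subCond, h']

lemma subCond_pos {c : H.edgeSet → ℝ} (hc : ∀ e, 0 < c e) (e : Sym2 H.verts) :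
    0 < subCond H c e := by
  rw [subCond]
  split_ifs
  · exact hc _
  · exact one_pos

variable [Fintype V]

lemma dirichletSum_subCond_le {c d : H.edgeSet → ℝ} {a : Sym2 V → ℝ} (hcd : c ≤ d)
    (hd : ∀ e, 0 < d e) (ha : ∀ e ∈ G.edgeSet, e ∉ H.edgeSet → 0 < a e) (f : V → ℝ) :
    dirichletSum H.coe (subCond H c) (fun x => f x) ≤ dirichletSum G (combineCond H d a) f := by
  have nonneg : ∀ x y, 0 ≤ if G.Adj x y then combineCond H d a s(x, y) * (f x - f y) ^ 2 else 0 := by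
    intro x y
    split_ifs with h
    · exact mul_nonneg (combineCond_pos hd ha _ h).le (sq_nonneg _)
    · exact le_rfl
  have restrict : ∀ g : V → ℝ, (∀ x, 0 ≤ g x) → ∑ x : H.verts, g x ≤ ∑ x, g x := by
    intro g hg
    rw [← Fintype.sum_subtype_add_sum_subtype (fun x => x ∈ H.verts) g]
    exact le_add_of_nonneg_right (Finset.sum_nonneg fun x _ => hg x)
  refine le_trans ?_ (restrict _ fun x => Finset.sum_nonneg fun y _ => nonneg x y)
  refine Finset.sum_le_sum fun x _ => ?_
  refine le_trans ?_ (restrict _ fun y => nonneg x y)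
  refine Finset.sum_le_sum fun y _ => ?_
  by_cases h : H.Adj x y
  · rw [if_pos (show H.coe.Adj x y from h), if_pos h.adj_sub,
      subCond_of_map_eq (e' := ⟨s((x : V), (y : V)), h⟩) c rfl,
      combineCond_coe d a ⟨s((x : V), (y : V)), h⟩]
    exact mul_le_mul_of_nonneg_right (hcd _) (sq_nonneg _)
  · rw [if_neg (show ¬ H.coe.Adj x y from h)]
    exact nonneg x y

/-- Rayleigh monotonicity for one edge: raising the conductance of an edge has a smaller relative
effect on the determinant of the larger network. -/
lemma gdet_update_mul_le (hG : G.Connected) (hH : H.Connected) (v : V) (v' : H.verts)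
    {c d : H.edgeSet → ℝ} {a : Sym2 V → ℝ} (hc : ∀ e, 0 < c e) (hd : ∀ e, 0 < d e)
    (ha : ∀ e ∈ G.edgeSet, e ∉ H.edgeSet → 0 < a e) (hcd : c ≤ d) (e : H.edgeSet) {t : ℝ}
    (ht : 0 ≤ t) :
    gdet H.coe (subCond H c) {v'} * gdet G (combineCond H (Function.update d e (d e + t)) a) {v}
      ≤ gdet H.coe (subCond H (Function.update c e (c e + t))) {v'}
        * gdet G (combineCond H d a) {v} := by
  obtain ⟨⟨p, q⟩, he⟩ := e
  have hadj : H.Adj p q := he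
  set e : H.edgeSet := ⟨s(p, q), he⟩
  let p' : H.verts := ⟨p, hadj.fst_mem⟩
  let q' : H.verts := ⟨q, hadj.snd_mem⟩
  have hmap : Sym2.map Subtype.val s(p', q') = (e : Sym2 V) := rfl
  have posG := combineCond_pos hd ha
  have posH : ∀ k ∈ H.coe.edgeSet, 0 < subCond H c k := fun k _ => subCond_pos hc k
  obtain ⟨R, hR, ⟨f, hf⟩, -⟩ := exists_gdet_update_eq hG posG v (p := p) (q := q) hadj.adj_sub
  obtain ⟨R', hR', -, hmax⟩ :=
    exists_gdet_update_eq (G := H.coe) hH.coe posH v' (p := p') (q := q') hadj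
  have hRR' : R ≤ R' := by
    have h₁ := hmax fun x => f x
    have h₂ := dirichletSum_subCond_le hcd hd ha f
    rw [hf]
    change 2 * (f p - f q) - _ ≤ R' at h₁
    linarith
  have hGt := hR t
  have hHt := hR' t
  rw [show s(p, q) = (e : Sym2 V) from rfl, combineCond_coe, ← combineCond_update] at hGt
  rw [subCond_of_map_eq c hmap, ← subCond_update c hmap] at hHt
  change _ * gdet G (combineCond H (Function.update d e (d e + t)) a) {v} ≤
    gdet H.coe (subCond H (Function.update c e (c e + t))) {v'} * _
  rw [hGt, hHt, mul_right_comm (gdet H.coe _ _), ← mul_assoc]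
  refine mul_le_mul_of_nonneg_left ?_
    (mul_pos (gdet_pos hH.coe posH v') (gdet_pos hG posG v)).le
  linarith [mul_le_mul_of_nonneg_left hRR' ht]

/-- The Holley condition for the two determinants. -/
lemma gdet_inf_mul_gdet_sup_le (hG : G.Connected) (hH : H.Connected) (v : V) (v' : H.verts)
    {x y : H.edgeSet → ℝ} {a : Sym2 V → ℝ} (hx : ∀ e, 0 < x e) (hy : ∀ e, 0 < y e)
    (ha : ∀ e ∈ G.edgeSet, e ∉ H.edgeSet → 0 < a e) :
    gdet H.coe (subCond H (x ⊓ y)) {v'} * gdet G (combineCond H (x ⊔ y) a) {v}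
      ≤ gdet H.coe (subCond H x) {v'} * gdet G (combineCond H y a) {v} := by
  have hm : ∀ e, 0 < (x ⊓ y) e := fun e => lt_inf_iff.2 ⟨hx e, hy e⟩
  have hM : ∀ e, 0 < (x ⊔ y) e := fun e => lt_sup_of_lt_left (hx e)
  have key : ∀ s : Finset H.edgeSet,
      gdet H.coe (subCond H (x ⊓ y)) {v'} * gdet G (combineCond H (s.piecewise (x ⊔ y) y) a) {v}
        ≤ gdet H.coe (subCond H (s.piecewise x (x ⊓ y))) {v'} * gdet G (combineCond H y a) {v} := by
    intro s
    induction s using Finset.induction with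
    | empty => simp
    | insert e s he ih =>
      have hc : ∀ k, 0 < s.piecewise x (x ⊓ y) k := fun k => by
        by_cases hk : k ∈ s
        · simpa [hk] using hx k
        · simpa [hk] using hm k
      have hd : ∀ k, 0 < s.piecewise (x ⊔ y) y k := fun k => by
        by_cases hk : k ∈ s
        · simpa only [hk, Finset.piecewise_eq_of_mem] using hM k
        · simpa [hk] using hy k
      have hcd : s.piecewise x (x ⊓ y) ≤ s.piecewise (x ⊔ y) y :=
        Finset.piecewise_le_piecewise s le_sup_left inf_le_right
      have step := gdet_update_mul_le hG hH v v' hc hd ha hcd e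
        (t := x e - (x ⊓ y) e) (sub_nonneg.2 inf_le_left)
      have hxe : s.piecewise x (x ⊓ y) e + (x e - (x ⊓ y) e) = x e := by
        simp [he]
      have hye : s.piecewise (x ⊔ y) y e + (x e - (x ⊓ y) e) = (x ⊔ y) e := by
        have := inf_add_sup (x e) (y e)
        simp only [he, not_false_eq_true, Finset.piecewise_eq_of_notMem, Pi.inf_apply, Pi.sup_apply]
        linarith
      rw [hxe, hye, ← Finset.piecewise_insert, ← Finset.piecewise_insert] at step
      have posH := gdet_pos (κ := subCond H (s.piecewise x (x ⊓ y))) hH.coe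
        (fun k _ => subCond_pos hc k) v'
      have posG := gdet_pos hG (combineCond_pos hd ha) v
      have posH₀ := gdet_pos (κ := subCond H (x ⊓ y)) hH.coe (fun k _ => subCond_pos hm k) v'
      refine le_of_mul_le_mul_left ?_ (mul_pos posH posG)
      have pos₁ := gdet_pos (κ := subCond H ((insert e s).piecewise x (x ⊓ y))) hH.coe
        (fun k _ => subCond_pos (fun k => by
          by_cases hk : k ∈ insert e s
          · simpa only [hk, Finset.piecewise_eq_of_mem] using hx k
          · simpa only [hk, not_false_eq_true, Finset.piecewise_eq_of_notMem] using hm k) k) v'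
      have := mul_le_mul step ih (mul_pos posH₀ posG).le (mul_pos pos₁ posG).le
      linarith
  simpa using key Finset.univ

lemma continuous_gdet {α X : Type*} [Fintype α] [TopologicalSpace X] (G : SimpleGraph α)
    (W : Set α) {κ : X → Sym2 α → ℝ} (hκ : ∀ e, Continuous fun c => κ c e) :
    Continuous fun c => gdet G (κ c) W := by
  refine Continuous.matrix_det (continuous_matrix fun i j => ?_)
  simp only [Matrix.submatrix_apply, glap, Matrix.of_apply]
  split_ifs
  · refine continuous_finsetSum _ fun z _ => ?_
    split_ifs
    · exact hκ _
    · exact continuous_const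
  · exact (hκ _).neg
  · exact continuous_const

lemma continuous_gdet_subCond (v' : H.verts) :
    Continuous fun c : H.edgeSet → ℝ => gdet H.coe (subCond H c) {v'} := by
  refine continuous_gdet _ _ fun e => ?_
  simp only [subCond]
  split_ifs
  · exact continuous_apply _
  · exact continuous_const

lemma continuous_gdet_combineCond (a : Sym2 V → ℝ) (v : V) :
    Continuous fun c : H.edgeSet → ℝ => gdet G (combineCond H c a) {v} := by
  refine continuous_gdet _ _ fun e => ?_
  simp only [combineCond]
  split_ifs
  · exact continuous_apply _
  · exact continuous_const

end Subgraph

/-- **Stochastic domination by the measure with boundary conditions**: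
`μ^{G′} ≼ μ^{G,E′,α}` where `μ^{G′}` has density `∝ D_{G′}(κ)^{-1/2}` and `μ^{G,E′,α}`
has density `∝ D_G((κ,α))^{-1/2}` with respect to `⊗_{e∈E′} ρ_e`. -/
theorem boundary_condition_stoch_dom
    {V : Type*} [Fintype V] (G : SimpleGraph V) (hconn : G.Connected)
    (H : G.Subgraph) (hHconn : H.Connected)
    (v₀ : V) (v₀' : H.verts)
    (lam : ℝ) (hlam : 1 ≤ lam)
    (ρ : H.edgeSet → Measure ℝ) [∀ e, IsFiniteMeasure (ρ e)]
    (hρne : ∀ e, ρ e ≠ 0)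
    (hρsupp : ∀ e, ρ e (Set.Icc lam⁻¹ lam)ᶜ = 0)
    (a : Sym2 V → ℝ) (hapos : ∀ e ∈ G.edgeSet, e ∉ H.edgeSet → 0 < a e)
    (Z₁ Z₂ : ℝ) (hZ₁ : 0 < Z₁) (hZ₂ : 0 < Z₂)
    (μsub μbc : Measure (H.edgeSet → ℝ))
    (hμsub : μsub = (Measure.pi ρ).withDensity fun c =>
      ENNReal.ofReal (Z₁ * (Real.sqrt (gdet H.coe (subCond H c) {v₀'}))⁻¹))
    (hμbc : μbc = (Measure.pi ρ).withDensity fun c =>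
      ENNReal.ofReal (Z₂ * (Real.sqrt (gdet G (combineCond H c a) {v₀}))⁻¹))
    [IsProbabilityMeasure μsub] [IsProbabilityMeasure μbc]
    (f : (H.edgeSet → ℝ) → ℝ) (hfmeas : Measurable f)
    (hfbdd : ∃ C : ℝ, ∀ c, |f c| ≤ C)
    (hfmono : ∀ c c' : H.edgeSet → ℝ,
      (∀ e, 0 < c e) → (∀ e, 0 < c' e) → c ≤ c' → f c ≤ f c') :
    ∫ c, f c ∂μsub ≤ ∫ c, f c ∂μbc := by
  subst hμsub hμbc
  refine integral_le_integral_of_holley ρ ?_ ?_ ?_ (fun x y hx hy => ?_) hfmeas hfbdd hfmono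
  · rw [eventually_countable_forall]
    intro e
    have h : ∀ᵐ r ∂ρ e, 0 < r := by
      filter_upwards [measure_eq_zero_iff_ae_notMem.1 (hρsupp e)] with r hr
      exact lt_of_lt_of_le (inv_pos.2 (one_pos.trans_le hlam)) (not_not.1 hr).1
    exact (Measure.tendsto_eval_ae_ae (μ := ρ) (i := e)).eventually h
  · exact (((continuous_gdet_subCond v₀').measurable.sqrt.inv).const_mul Z₁).ennreal_ofReal
  · exact (((continuous_gdet_combineCond a v₀).measurable.sqrt.inv).const_mul Z₂).ennreal_ofReal
  · have hm : ∀ e, 0 < (x ⊓ y) e := fun e => lt_inf_iff.2 ⟨hx e, hy e⟩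
    have hM : ∀ e, 0 < (x ⊔ y) e := fun e => lt_sup_of_lt_left (hx e)
    have posH := gdet_pos (κ := subCond H (x ⊓ y)) hHconn.coe (fun k _ => subCond_pos hm k) v₀'
    have posG := gdet_pos hconn (combineCond_pos hM hapos) v₀
    have hdet := gdet_inf_mul_gdet_sup_le hconn hHconn v₀ v₀' hx hy hapos
    have hsqrt := inv_anti₀ (Real.sqrt_pos.2 (mul_pos posH posG)) (Real.sqrt_le_sqrt hdet)
    have hH : 0 ≤ gdet H.coe (subCond H x) {v₀'} :=
      (gdet_pos hHconn.coe (fun k _ => subCond_pos hx k) v₀').le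
    rw [Real.sqrt_mul posH.le, Real.sqrt_mul hH, mul_inv, mul_inv] at hsqrt
    rw [← ENNReal.ofReal_mul (by positivity), ← ENNReal.ofReal_mul (by positivity)]
    refine ENNReal.ofReal_le_ofReal ?_
    linarith [mul_le_mul_of_nonneg_left hsqrt (mul_pos hZ₁ hZ₂).le]
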